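/- Let k be a field and A a metabelian k-algebra (the product of any four elements of A is zero) whose derived subalgebra A' has codimension 1 in A. Then there exist a k-vector space V, endomorphisms λ, Λ ∈ End_k(V) with λ² = Λ² = 0 and Λ∘λ = λ∘Λ, and ζ ∈ V with Λ(ζ) = λ(ζ), together with an algebra isomorphism from A onto the algebra k ⋆_{(λ,Λ,ζ)} V on k × V with multiplication (p, x) ⋆ (q, y) := (0, pq·ζ + p·Λ(y) + q·λ(x)). -/

import Mathlib

/-- The derived subalgebra of `A`: the span of all products. -/
def derivedSpan (k A : Type*) [Field k] [NonUnitalRing A] [Module k A] : Submodule k A :=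
  Submodule.span k {c : A | ∃ x y : A, c = x * y}

section derivedSpan

variable {k A : Type*} [Field k] [NonUnitalRing A] [Module k A]

theorem mul_mem_derivedSpan (x y : A) : x * y ∈ derivedSpan k A :=
  Submodule.subset_span ⟨x, y, rfl⟩

theorem mul_mul_eq_zero_of_mem_derivedSpan [SMulCommClass k A A] [IsScalarTower k A A]
    (hmet : ∀ x y z t : A, x * y * z * t = 0) {x : A} (hx : x ∈ derivedSpan k A) (a b : A) :
    x * a * b = 0 ∧ a * x * b = 0 ∧ a * b * x = 0 := by
  induction hx using Submodule.span_induction with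
  | mem x h =>
    obtain ⟨y, z, rfl⟩ := h
    exact ⟨hmet _ _ _ _, by rw [← mul_assoc, hmet], by rw [← mul_assoc, hmet]⟩
  | zero => simp
  | add x y _ _ hx hy => simp [add_mul, mul_add, hx, hy]
  | smul c x _ hx => simp [smul_mul_assoc, mul_smul_comm, hx]

theorem mul_eq_zero_of_mem_derivedSpan [SMulCommClass k A A] [IsScalarTower k A A]
    (hmet : ∀ x y z t : A, x * y * z * t = 0) {x y : A} (hx : x ∈ derivedSpan k A)
    (hy : y ∈ derivedSpan k A) : x * y = 0 := by
  induction hy using Submodule.span_induction with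
  | mem y h =>
    obtain ⟨a, b, rfl⟩ := h
    rw [← mul_assoc, (mul_mul_eq_zero_of_mem_derivedSpan hmet hx a b).1]
  | zero => simp
  | add y z _ _ hy hz => simp [mul_add, hy, hz]
  | smul c y _ hy => simp [mul_smul_comm, hy]

end derivedSpan

/-- A submodule with one-dimensional quotient is the kernel of a linear functional that takes
the value `1`. -/
theorem Submodule.exists_ker_eq_of_rank_quotient_eq_one {k A : Type*} [Field k] [AddCommGroup A]
    [Module k A] (W : Submodule k A) (h : Module.rank k (A ⧸ W) = 1) :
    ∃ (ε : A →ₗ[k] k) (f : A), LinearMap.ker ε = W ∧ ε f = 1 := by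
  have e : (A ⧸ W) ≃ₗ[k] k :=
    (Module.basisUnique Unit (Module.rank_eq_one_iff_finrank_eq_one.1 h)).repr.trans
      (Finsupp.uniqueLinearEquiv k k ())
  obtain ⟨f, hf⟩ := W.mkQ_surjective (e.symm 1)
  exact ⟨e.toLinearMap ∘ₗ W.mkQ, f, by simp [LinearEquiv.ker_comp],
    by simp only [LinearMap.comp_apply, hf]; simp⟩

/-- The splitting `A ≃ k × ker ε` given by a vector `f` with `ε f = 1`. -/
def LinearMap.prodKerEquiv {k A : Type*} [Field k] [AddCommGroup A] [Module k A]
    (ε : A →ₗ[k] k) (f : A) (hf : ε f = 1) : A ≃ₗ[k] k × LinearMap.ker ε where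
  toFun a := (ε a, ⟨a - ε a • f, by simp [hf]⟩)
  invFun p := p.1 • f + p.2
  map_add' a b := by
    ext
    · simp
    · simp only [map_add, Prod.mk_add_mk, Submodule.coe_add]
      module
  map_smul' c a := by
    ext
    · simp
    · simp only [map_smul, smul_eq_mul, RingHom.id_apply, Prod.smul_mk, Submodule.coe_smul]
      module
  left_inv a := by simp
  right_inv p := by
    have hp : ε p.2 = 0 := p.2.2
    ext <;> simp [hf, hp]


/-- Every metabelian algebra `A` (the product of any four elements is zero) whose derived
subalgebra `A'` has codimension `1` (i.e. `A / A'` is `1`-dimensional) is isomorphic, as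
an algebra, to a metabelian product `k ⋆_{(λ,Λ,ζ)} V`: the algebra on `k × V` with
multiplication `(p, x) ⋆ (q, y) = (0, (p q) • ζ + p • Λ y + q • λ x)`, for some vector
space `V`, endomorphisms `λ, Λ` with `λ² = Λ² = 0`, `Λ∘λ = λ∘Λ`, and `ζ ∈ Ker (Λ - λ)`. -/
theorem metabelian_derived_codim_one_iso_kStar.{u}
    {k : Type*} [Field k] {A : Type u} [NonUnitalRing A] [Module k A]
    [SMulCommClass k A A] [IsScalarTower k A A]
    (hmet : ∀ x y z t : A, x * y * z * t = 0)
    (hcodim :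
      Module.rank k (A ⧸ Submodule.span k {c : A | ∃ x y : A, c = x * y}) = 1) :
    ∃ (V : Type u) (_ : AddCommGroup V) (_ : Module k V)
      (lam Lam : V →ₗ[k] V) (ζ : V),
      lam ∘ₗ lam = 0 ∧ Lam ∘ₗ Lam = 0 ∧ Lam ∘ₗ lam = lam ∘ₗ Lam ∧ Lam ζ = lam ζ ∧
      ∃ φ : A ≃ₗ[k] k × V,
        ∀ a b : A, φ (a * b) =
          (((0 : k), ((φ a).1 * (φ b).1) • ζ + (φ a).1 • Lam (φ b).2 +
            (φ b).1 • lam (φ a).2) : k × V) := by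
  obtain ⟨ε, f, hε, hf⟩ := Submodule.exists_ker_eq_of_rank_quotient_eq_one _ hcodim
  change LinearMap.ker ε = derivedSpan k A at hε
  have hmul (a b : A) : a * b ∈ LinearMap.ker ε := hε ▸ mul_mem_derivedSpan a b
  have hzero (x : LinearMap.ker ε) (a b : A) := mul_mul_eq_zero_of_mem_derivedSpan hmet
    (hε ▸ x.2 : (x : A) ∈ derivedSpan k A) a b
  refine ⟨LinearMap.ker ε, inferInstance, inferInstance,
    ((LinearMap.mulRight k f).comp (LinearMap.ker ε).subtype).codRestrict _ fun x => hmul x f,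
    ((LinearMap.mulLeft k f).comp (LinearMap.ker ε).subtype).codRestrict _ fun x => hmul f x,
    ⟨f * f, hmul f f⟩, ?_, ?_, ?_, ?_, ε.prodKerEquiv f hf, fun a b => ?_⟩
  · ext x
    exact (hzero x f f).1
  · ext x
    exact (mul_assoc f f (x : A)).symm.trans (hzero x f f).2.2
  · ext x
    exact (mul_assoc f (x : A) f).symm
  · ext
    exact (mul_assoc f f f).symm
  · have hab : ε (a * b) = 0 := hmul a b
    have key : (a - ε a • f) * (b - ε b • f) = 0 :=
      mul_eq_zero_of_mem_derivedSpan (k := k) hmet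
        (hε ▸ (by simp [hf] : a - ε a • f ∈ LinearMap.ker ε))
        (hε ▸ (by simp [hf] : b - ε b • f ∈ LinearMap.ker ε))
    ext
    · exact hab
    · change a * b - ε (a * b) • f = (ε a * ε b) • (f * f) + ε a • (f * (b - ε b • f)) +
        ε b • ((a - ε a • f) * f)
      rw [hab, ← sub_eq_zero, ← key]
      simp only [sub_mul, mul_sub, smul_mul_assoc, mul_smul_comm]
      module
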